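/- Let N ≥ 1, let Q be the standard Gaussian measure on ℝ^N (the N-fold product of standard real normal distributions), let P₀ be a compactly supported Borel probability measure on ℝ^N, and let P be the law of θ + Z where θ ∼ P₀ and Z ∼ Q are independent. Then P is absolutely continuous with respect to Q with density L(y) = E_{θ}[exp(⟨y, θ⟩ − ‖θ‖²/2)], and for every D ∈ ℕ, if L^{≤D} denotes the orthogonal projection in L²(Q) of L onto the (finite-dimensional) subspace spanned by equivalence classes of polynomial functions ℝ^N → ℝ of total degree at most D, then ‖L^{≤D}‖²_{L²(Q)} = Σ_{d=0}^{D} (1/d!) · E[⟨θ, θ′⟩^d], where θ and θ′ are independent draws from P₀ and ⟨·,·⟩ is the Euclidean inner product on ℝ^N. -/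

import Mathlib

open MeasureTheory ProbabilityTheory Filter

noncomputable def Hp (n : ℕ) : Polynomial ℝ := (Polynomial.hermite n).map (Int.castRingHom ℝ)

lemma Hp_succ (n : ℕ) : Hp (n+1) = Polynomial.X * Hp n - Polynomial.derivative (Hp n) := by
  simp [Hp, Polynomial.hermite_succ, Polynomial.derivative_map]

lemma Hp_zero : Hp 0 = 1 := by simp [Hp]

lemma Hp_monic (n : ℕ) : (Hp n).Monic := (Polynomial.hermite_monic n).map _

lemma Hp_natDegree (n : ℕ) : (Hp n).natDegree = n := by
  rw [Hp, (Polynomial.hermite_monic n).natDegree_map, Polynomial.natDegree_hermite]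

noncomputable def gex (t x : ℝ) : ℝ := Real.exp (t * x - t ^ 2 / 2)

lemma integrable_poly_exp (p : Polynomial ℝ) (t : ℝ) :
    Integrable (fun x => p.eval x * Real.exp (t * x)) (gaussianReal 0 1) := by
  simp_rw [Polynomial.eval_eq_sum_range, Finset.sum_mul, mul_assoc]
  refine integrable_finsetSum _ fun i _ => Integrable.const_mul ?_ _
  exact integrable_pow_mul_exp_of_mem_interior_integrableExpSet (X := fun x : ℝ => x)
    (by rw [integrableExpSet_fun_id_gaussianReal]; simp) i

lemma integrable_poly_gex (p : Polynomial ℝ) (t : ℝ) :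
    Integrable (fun x => p.eval x * gex t x) (gaussianReal 0 1) := by
  have := (integrable_poly_exp p t).mul_const (Real.exp (-(t^2/2)))
  refine this.congr (ae_of_all _ fun x => ?_)
  simp only [gex, mul_assoc, ← Real.exp_add, sub_eq_add_neg]

lemma integrable_poly (p : Polynomial ℝ) :
    Integrable (fun x => p.eval x) (gaussianReal 0 1) := by
  simpa using integrable_poly_exp p 0

lemma integrable_gauss_mul {f : ℝ → ℝ} (h : Integrable f (gaussianReal 0 1)) :
    Integrable (fun x => gaussianPDFReal 0 1 x * f x) := by
  rw [gaussianReal_of_var_ne_zero 0 one_ne_zero] at h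
  rw [integrable_withDensity_iff_integrable_smul' (measurable_gaussianPDF 0 1)
    (ae_of_all _ fun x => gaussianPDF_lt_top)] at h
  simpa using h

lemma stein (p : Polynomial ℝ) (t : ℝ) :
    ∫ x, x * p.eval x * gex t x ∂(gaussianReal 0 1)
      = ∫ x, p.derivative.eval x * gex t x ∂(gaussianReal 0 1)
        + t * ∫ x, p.eval x * gex t x ∂(gaussianReal 0 1) := by
  have hd : ∀ x, HasDerivAt (fun x => gaussianPDFReal 0 1 x * (p.eval x * gex t x))
      (gaussianPDFReal 0 1 x * ((p.derivative + Polynomial.C t * p - Polynomial.X * p).eval x * gex t x)) x := by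
    intro x
    have h1 : HasDerivAt (gaussianPDFReal 0 1) (gaussianPDFReal 0 1 x * (-x)) x := by
      have : HasDerivAt (fun x : ℝ => -(x - 0)^2 / (2 * ((1:NNReal):ℝ))) (-x) x := by
        have := (((hasDerivAt_id x).sub_const 0).pow 2).neg.div_const (2 * ((1:NNReal):ℝ))
        convert! this using 1
        simp
        ring
      have := this.exp.const_mul ((√(2 * Real.pi * (1:NNReal)))⁻¹)
      rw [gaussianPDFReal_def]
      convert! this using 1
      ring
    have h2 : HasDerivAt (gex t) (gex t x * t) x := by
      have := (((hasDerivAt_id x).const_mul t).sub_const (t^2/2)).exp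
      simpa [gex] using! this
    convert! h1.mul ((p.hasDerivAt x).mul h2) using 1
    simp only [Polynomial.eval_add, Polynomial.eval_sub, Polynomial.eval_mul, Polynomial.eval_C,
      Polynomial.eval_X, Pi.mul_apply]
    ring
  have h0 := integral_eq_zero_of_hasDerivAt_of_integrable hd
    (integrable_gauss_mul (integrable_poly_gex _ t)) (integrable_gauss_mul (integrable_poly_gex _ t))
  have h3 := integral_gaussianReal_eq_integral_smul (μ := 0) (v := 1) (f := fun x => (p.derivative + Polynomial.C t * p - Polynomial.X * p).eval x * gex t x) one_ne_zero
  simp only [smul_eq_mul] at h3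
  rw [h0] at h3
  have e : ∀ x, (p.derivative + Polynomial.C t * p - Polynomial.X * p).eval x * gex t x
    = (p.derivative.eval x * gex t x + t * (p.eval x * gex t x)) - x * p.eval x * gex t x := by
    intro x
    simp only [Polynomial.eval_add, Polynomial.eval_sub, Polynomial.eval_mul, Polynomial.eval_C,
      Polynomial.eval_X]
    ring
  have iX : Integrable (fun x => x * p.eval x * gex t x) (gaussianReal 0 1) := by
    exact (integrable_poly_gex (Polynomial.X * p) t).congr (ae_of_all _ fun x => by simp)
  simp_rw [e] at h3
  have iA : Integrable (fun x => p.derivative.eval x * gex t x + t * (p.eval x * gex t x)) (gaussianReal 0 1) :=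
    (integrable_poly_gex _ t).add ((integrable_poly_gex _ t).const_mul t)
  rw [integral_sub iA iX,
    integral_add (integrable_poly_gex _ t) ((integrable_poly_gex _ t).const_mul t),
    integral_const_mul] at h3
  linarith

lemma integral_gex (t : ℝ) : ∫ x, gex t x ∂(gaussianReal 0 1) = 1 := by
  have := congrFun (mgf_fun_id_gaussianReal (μ := 0) (v := 1)) t
  simp only [mgf] at this
  simp only [gex, Real.exp_sub, integral_div, this]
  simp

lemma integral_Hp_gex (n : ℕ) (t : ℝ) :
    ∫ x, (Hp n).eval x * gex t x ∂(gaussianReal 0 1) = t ^ n := by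
  induction n with
  | zero => simp [Hp_zero, integral_gex]
  | succ n ih =>
    have := stein (Hp n) t
    rw [ih] at this
    simp only [Hp_succ, Polynomial.eval_sub, Polynomial.eval_mul, Polynomial.eval_X, sub_mul]
    have iX : Integrable (fun x => x * (Hp n).eval x * gex t x) (gaussianReal 0 1) := by
      exact (integrable_poly_gex (Polynomial.X * (Hp n)) t).congr (ae_of_all _ fun x => by simp)
    rw [integral_sub iX (integrable_poly_gex _ t), this]
    ring

lemma integral_Hp_mul (n : ℕ) (p : Polynomial ℝ) :
    ∫ x, (Hp n).eval x * p.eval x ∂(gaussianReal 0 1)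
      = ∫ x, (Polynomial.derivative^[n] p).eval x ∂(gaussianReal 0 1) := by
  induction n generalizing p with
  | zero => simp [Hp_zero]
  | succ n ih =>
    have := stein (Hp n * p) 0
    simp only [gex, Polynomial.derivative_mul] at this
    simp at this
    rw [Function.iterate_succ_apply, ← ih]
    simp only [Hp_succ, Polynomial.eval_sub, Polynomial.eval_mul, Polynomial.eval_X, sub_mul]
    have i1 := integrable_poly (Polynomial.X * (Hp n) * p)
    have i2 := integrable_poly (Polynomial.derivative (Hp n) * p)
    have i3 := integrable_poly (Hp n * Polynomial.derivative p)
    simp only [Polynomial.eval_mul, Polynomial.eval_X] at i1 i2 i3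
    rw [integral_sub i1 i2]
    rw [integral_add i2 i3] at this
    simp only [mul_assoc] at this ⊢
    linarith

lemma Hp_orth (n m : ℕ) :
    ∫ x, (Hp n).eval x * (Hp m).eval x ∂(gaussianReal 0 1) = if n = m then (n.factorial : ℝ) else 0 := by
  have key : ∀ n m, m < n → ∫ x, (Hp n).eval x * (Hp m).eval x ∂(gaussianReal 0 1) = 0 := by
    intro n m h
    rw [integral_Hp_mul, Polynomial.iterate_derivative_eq_zero (by rw [Hp_natDegree]; exact h)]
    simp
  split_ifs with h
  · subst h
    rw [integral_Hp_mul]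
    have : Polynomial.derivative^[n] (Hp n) = Polynomial.C (n.factorial : ℝ) := by
      have h1 := Polynomial.natDegree_iterate_derivative (Hp n) n
      rw [Hp_natDegree, Nat.sub_self, Nat.le_zero] at h1
      rw [Polynomial.eq_C_of_natDegree_eq_zero h1, Polynomial.coeff_iterate_derivative]
      have h2 : (Hp n).coeff n = 1 := by
        have := Hp_monic n
        rwa [Polynomial.Monic, Polynomial.leadingCoeff, Hp_natDegree] at this
      simp [h2, Nat.descFactorial_self]
    simp [this]
  · rcases lt_or_gt_of_ne h with h | h
    · simp_rw [mul_comm (Polynomial.eval _ (Hp n))]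
      exact key _ _ h
    · exact key _ _ h

lemma pow_expand (k : ℕ) : ∃ c : ℕ → ℝ, ∀ x : ℝ, x ^ k = ∑ j ∈ Finset.range (k+1), c j * (Hp j).eval x := by
  have gen : ∀ n (p : Polynomial ℝ), p.natDegree < n →
      ∃ c : ℕ → ℝ, ∀ x : ℝ, p.eval x = ∑ j ∈ Finset.range n, c j * (Hp j).eval x := by
    intro n
    induction n with
    | zero => intro p hp; omega
    | succ n ih =>
      intro p hp
      set q := p - Polynomial.C (p.coeff n) * Hp n with hq
      have hpq : ∀ x, p.eval x = q.eval x + p.coeff n * (Hp n).eval x := by intro x; simp [hq]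
      have hqd : q.degree < n := by
        rw [Polynomial.degree_lt_iff_coeff_zero]
        intro m hm
        have h2 : (Hp n).coeff n = 1 := by
          have := Hp_monic n
          rwa [Polynomial.Monic, Polynomial.leadingCoeff, Hp_natDegree] at this
        rcases hm.eq_or_lt with h | h
        · subst h; simp [hq, h2]
        · simp [hq, Polynomial.coeff_eq_zero_of_natDegree_lt (p := Hp n) (by rw [Hp_natDegree]; exact h),
            Polynomial.coeff_eq_zero_of_natDegree_lt (p := p) (n := m) (by omega)]
      by_cases hn : n = 0
      · subst hn
        refine ⟨fun _ => p.coeff 0, fun x => ?_⟩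
        have : q = 0 := by
          by_contra h
          have := Polynomial.zero_le_degree_iff.2 h
          exact absurd hqd (not_lt.2 this)
        rw [hpq, this]; simp
      · obtain ⟨c, hc⟩ := ih q (by
          by_cases h0 : q = 0
          · rw [h0]; simp; omega
          · exact (Polynomial.natDegree_lt_iff_degree_lt h0).2 hqd)
        refine ⟨fun j => if j = n then p.coeff n else c j, fun x => ?_⟩
        rw [Finset.sum_range_succ, hpq, hc]
        simp only [if_true]
        congr 1
        refine Finset.sum_congr rfl fun j hj => ?_
        rw [if_neg (by have := Finset.mem_range.1 hj; omega)]
  obtain ⟨c, hc⟩ := gen (k+1) (Polynomial.X ^ k) (by simp)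
  exact ⟨c, fun x => by simpa using hc x⟩

noncomputable def HM {N : ℕ} (β : Fin N → ℕ) (y : Fin N → ℝ) : ℝ := ∏ i, (Hp (β i)).eval (y i)

noncomputable def HMp {N : ℕ} (β : Fin N → ℕ) : MvPolynomial (Fin N) ℝ :=
  ∏ i, (Hp (β i)).toMvPolynomial i

lemma eval_HMp {N : ℕ} (β : Fin N → ℕ) (y : Fin N → ℝ) : MvPolynomial.eval y (HMp β) = HM β y := by
  simp [HMp, HM, map_prod]

lemma totalDegree_HMp {N : ℕ} (β : Fin N → ℕ) : (HMp β).totalDegree ≤ ∑ i, β i := by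
  refine (MvPolynomial.totalDegree_finsetProd _ _).trans (Finset.sum_le_sum fun i _ => ?_)
  rw [Polynomial.toMvPolynomial, Polynomial.aeval_eq_sum_range, Hp_natDegree]
  refine MvPolynomial.totalDegree_finsetSum_le fun j hj => ?_
  refine (MvPolynomial.totalDegree_smul_le _ _).trans ?_
  rw [MvPolynomial.totalDegree_X_pow]
  have := Finset.mem_range.1 hj
  omega

lemma gex_prod {N : ℕ} (θ y : Fin N → ℝ) :
    Real.exp ((∑ i, y i * θ i) - (∑ i, θ i ^ 2) / 2) = ∏ i, gex (θ i) (y i) := by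
  simp only [gex, ← Real.exp_sum, Finset.sum_sub_distrib, Finset.sum_div, mul_comm]

lemma HM_orth {N : ℕ} (β γ : Fin N → ℕ) :
    ∫ y, HM β y * HM γ y ∂(Measure.pi fun _ => gaussianReal 0 1)
      = if β = γ then ((∏ i, (β i).factorial : ℕ) : ℝ) else 0 := by
  simp only [HM, ← Finset.prod_mul_distrib]
  rw [integral_fintype_prod_eq_prod (fun i x => (Hp (β i)).eval x * (Hp (γ i)).eval x)]
  simp only [Hp_orth]
  split_ifs with h
  · subst h; simp
  · obtain ⟨i, hi⟩ := Function.ne_iff.1 h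
    exact Finset.prod_eq_zero (Finset.mem_univ i) (by simp [hi])

lemma HM_gex {N : ℕ} (β : Fin N → ℕ) (θ : Fin N → ℝ) :
    ∫ y, HM β y * ∏ i, gex (θ i) (y i) ∂(Measure.pi fun _ => gaussianReal 0 1)
      = ∏ i, θ i ^ β i := by
  simp only [HM, ← Finset.prod_mul_distrib]
  rw [integral_fintype_prod_eq_prod (fun i x => (Hp (β i)).eval x * gex (θ i) x)]
  simp only [integral_Hp_gex]

lemma HM_continuous {N : ℕ} (β : Fin N → ℕ) : Continuous (HM β) := by
  unfold HM
  fun_prop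

lemma HM_memLp {N : ℕ} (β : Fin N → ℕ) :
    MemLp (HM β) 2 (Measure.pi fun _ => gaussianReal 0 1) := by
  rw [memLp_two_iff_integrable_sq (HM_continuous β).aestronglyMeasurable]
  simp only [HM, ← Finset.prod_pow]
  refine Integrable.fintype_prod (f := fun i x => (Hp (β i)).eval x ^ 2) fun i => ?_
  exact (integrable_poly ((Hp (β i)) ^ 2)).congr (ae_of_all _ fun x => by simp)

lemma monomial_expand {N : ℕ} (α : Fin N → ℕ) : ∃ a : (Fin N → ℕ) → ℝ, ∀ y : Fin N → ℝ,
    ∏ i, y i ^ α i = ∑ β ∈ Fintype.piFinset (fun i => Finset.range (α i + 1)), a β * HM β y := by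
  choose c hc using pow_expand
  refine ⟨fun β => ∏ i, c (α i) (β i), fun y => ?_⟩
  simp only [HM, ← Finset.prod_mul_distrib]
  rw [← Finset.prod_univ_sum (fun i => Finset.range (α i + 1))
    (fun i j => c (α i) j * (Hp j).eval (y i))]
  exact Finset.prod_congr rfl fun i _ => hc _ _

noncomputable def SS (N D : ℕ) : Finset (Fin N → ℕ) :=
  (Finset.range (D + 1)).biUnion fun d => Finset.piAntidiag Finset.univ d

lemma mem_SS {N D : ℕ} (β : Fin N → ℕ) : β ∈ SS N D ↔ ∑ i, β i ≤ D := by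
  simp [SS]

lemma sum_SS {N D : ℕ} (f : (Fin N → ℕ) → ℝ) :
    ∑ β ∈ SS N D, f β = ∑ d ∈ Finset.range (D + 1), ∑ β ∈ Finset.piAntidiag Finset.univ d, f β := by
  rw [SS, Finset.sum_biUnion]
  intro d _ e _ hde
  rw [Function.onFun, Finset.disjoint_left]
  intro β h1 h2
  simp at h1 h2
  exact hde (h1.symm.trans h2)

lemma poly_expand {N D : ℕ} (p : MvPolynomial (Fin N) ℝ) (hp : p.totalDegree ≤ D) :
    ∃ a : (Fin N → ℕ) → ℝ, ∀ y, MvPolynomial.eval y p = ∑ β ∈ SS N D, a β * HM β y := by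
  choose a ha using @monomial_expand N
  refine ⟨fun β => ∑ α ∈ p.support, p.coeff α *
    (if β ∈ Fintype.piFinset (fun i => Finset.range (α i + 1)) then a α β else 0), fun y => ?_⟩
  rw [MvPolynomial.eval_eq']
  simp only [Finset.sum_mul]
  rw [Finset.sum_comm]
  refine Finset.sum_congr rfl fun α hα => ?_
  rw [ha]
  simp only [mul_assoc, ite_mul, zero_mul]
  rw [← Finset.mul_sum, ← Finset.sum_filter]
  congr 1
  refine Finset.sum_congr ?_ fun _ _ => rfl
  ext β
  simp only [Finset.mem_filter, mem_SS, iff_and_self, Fintype.mem_piFinset, Finset.mem_range, Nat.lt_succ_iff]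
  intro h
  refine (Finset.sum_le_sum fun i _ => h i).trans (le_trans ?_ hp)
  have := MvPolynomial.le_totalDegree hα
  rwa [Finsupp.sum_fintype _ _ (fun _ => rfl)] at this

lemma integrable_of_compact {N : ℕ} (P₀ : Measure (Fin N → ℝ)) [IsProbabilityMeasure P₀]
    (hcompact : ∃ K : Set (Fin N → ℝ), IsCompact K ∧ P₀ Kᶜ = 0) {f : (Fin N → ℝ) → ℝ}
    (hf : Continuous f) : Integrable f P₀ := by
  obtain ⟨K, hK, h0⟩ := hcompact
  have : P₀.restrict K = P₀ := Measure.restrict_eq_self_of_ae_mem (by rw [ae_iff]; exact h0)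
  rw [← this]
  exact hf.continuousOn.integrableOn_compact hK

lemma gex_nonneg (t x : ℝ) : 0 ≤ gex t x := (Real.exp_pos _).le

lemma shift_Q {N : ℕ} (θ : Fin N → ℝ) :
    (Measure.pi fun _ : Fin N => gaussianReal 0 1).map (fun z => θ + z)
      = (Measure.pi fun _ => gaussianReal 0 1).withDensity
        (fun y => ENNReal.ofReal (∏ i, gex (θ i) (y i))) := by
  have h1 : ∀ t : ℝ, ∀ s : Set ℝ, MeasurableSet s → gaussianReal t 1 s = ENNReal.ofReal (∫ x, s.indicator (gex t) x ∂gaussianReal 0 1) := by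
    intro t s hs
    rw [gaussianReal_apply_eq_integral _ one_ne_zero, integral_gaussianReal_eq_integral_smul one_ne_zero,
      ← integral_indicator hs]
    congr 2
    ext x
    by_cases hx : x ∈ s
    · simp only [Set.indicator_of_mem hx, gaussianPDFReal, gex, smul_eq_mul, mul_assoc, ← Real.exp_add]
      congr 2
      simp
      ring
    · simp [hx]
  have hi : ∀ t : ℝ, Integrable (gex t) (gaussianReal 0 1) := fun t => by
    simpa using integrable_poly_gex 1 t
  have hm : (Measure.pi fun _ : Fin N => gaussianReal 0 1).map (fun z => θ + z)
      = Measure.pi fun i => gaussianReal (θ i) 1 := by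
    have := Measure.pi_map_pi (μ := fun _ : Fin N => gaussianReal 0 1) (f := fun i x => θ i + x)
      (fun i => by fun_prop)
    simp only [gaussianReal_map_const_add, zero_add] at this
    exact this
  rw [hm]
  refine Measure.pi_eq fun s hs => ?_
  rw [withDensity_apply _ (MeasurableSet.univ_pi hs), ← lintegral_indicator (MeasurableSet.univ_pi hs)]
  have e : ∀ y : Fin N → ℝ, (Set.univ.pi s).indicator (fun y => ENNReal.ofReal (∏ i, gex (θ i) (y i))) y
      = ENNReal.ofReal (∏ i, (s i).indicator (gex (θ i)) (y i)) := by
    intro y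
    by_cases hy : y ∈ Set.univ.pi s
    · rw [Set.indicator_of_mem hy]
      congr 1
      refine Finset.prod_congr rfl fun i _ => ?_
      rw [Set.indicator_of_mem (hy i (Set.mem_univ i))]
    · rw [Set.indicator_of_notMem hy]
      simp only [Set.mem_pi, Set.mem_univ, true_implies, not_forall] at hy
      obtain ⟨i, hi⟩ := hy
      rw [Finset.prod_eq_zero (Finset.mem_univ i) (Set.indicator_of_notMem hi _)]
      simp
  simp_rw [e]
  have hn : ∀ i x, 0 ≤ (s i).indicator (gex (θ i)) x := fun i x =>
    Set.indicator_nonneg (fun _ _ => gex_nonneg _ _) _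
  rw [← ofReal_integral_eq_lintegral_ofReal
    (Integrable.fintype_prod (f := fun i => (s i).indicator (gex (θ i))) fun i => (hi _).indicator (hs i))
    (ae_of_all _ fun y => Finset.prod_nonneg fun i _ => hn i _),
    integral_fintype_prod_eq_prod (fun i => (s i).indicator (gex (θ i))),
    ENNReal.ofReal_prod_of_nonneg fun i _ => integral_nonneg (hn i)]
  exact Finset.prod_congr rfl fun i _ => (h1 _ _ (hs i)).symm

lemma gexM_cont {N : ℕ} : Continuous (fun p : (Fin N → ℝ) × (Fin N → ℝ) => ∏ i, gex (p.1 i) (p.2 i)) := by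
  unfold gex
  fun_prop

lemma density {N : ℕ} (P₀ : Measure (Fin N → ℝ)) [IsProbabilityMeasure P₀]
    (hcompact : ∃ K : Set (Fin N → ℝ), IsCompact K ∧ P₀ Kᶜ = 0) :
    (P₀.prod (Measure.pi fun _ : Fin N => gaussianReal 0 1)).map (fun p => p.1 + p.2)
     = (Measure.pi fun _ => gaussianReal 0 1).withDensity
        (fun y => ENNReal.ofReal (∫ θ, ∏ i, gex (θ i) (y i) ∂P₀)) := by
  ext A hA
  have hL : ∀ y : Fin N → ℝ, ENNReal.ofReal (∫ θ, ∏ i, gex (θ i) (y i) ∂P₀) =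
      ∫⁻ θ, ENNReal.ofReal (∏ i, gex (θ i) (y i)) ∂P₀ := fun y =>
    ofReal_integral_eq_lintegral_ofReal (integrable_of_compact P₀ hcompact
      (gexM_cont.comp (by fun_prop : Continuous fun θ => (θ, y))))
      (ae_of_all _ fun y => Finset.prod_nonneg fun i _ => gex_nonneg _ _)
  rw [Measure.map_apply (by fun_prop) hA, Measure.prod_apply (hA.preimage (by fun_prop)),
    withDensity_apply _ hA]
  simp_rw [hL]
  rw [lintegral_lintegral_swap]
  · refine lintegral_congr fun θ => ?_
    rw [← withDensity_apply _ hA, ← shift_Q, Measure.map_apply (by fun_prop) hA]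
    rfl
  · exact (ENNReal.measurable_ofReal.comp
      (gexM_cont.measurable.comp measurable_swap)).aemeasurable

lemma inner_L {N : ℕ} (P₀ : Measure (Fin N → ℝ)) [IsProbabilityMeasure P₀]
    (hcompact : ∃ K : Set (Fin N → ℝ), IsCompact K ∧ P₀ Kᶜ = 0) (β : Fin N → ℕ) :
    ∫ y, HM β y * ∫ θ, ∏ i, gex (θ i) (y i) ∂P₀ ∂(Measure.pi fun _ => gaussianReal 0 1)
     = ∫ θ, ∏ i, θ i ^ β i ∂P₀ := by
  simp_rw [← integral_const_mul]
  rw [integral_integral_swap]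
  · simp_rw [HM_gex]
  · obtain ⟨K, hK, h0⟩ := hcompact
    obtain ⟨R, hR⟩ := hK.isBounded.exists_norm_le
    have hae : ∀ᵐ θ ∂P₀, ∀ i, |θ i| ≤ R := by
      have : ∀ᵐ θ ∂P₀, θ ∈ K := by rw [ae_iff]; exact h0
      filter_upwards [this] with θ hθ i
      exact (norm_le_pi_norm θ i).trans (hR θ hθ)
    have hg : Integrable (fun y : Fin N → ℝ => ∏ i, |(Hp (β i)).eval (y i)| * (Real.exp (R * y i) + Real.exp (-R * y i)))
        (Measure.pi fun _ => gaussianReal 0 1) := by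
      refine Integrable.fintype_prod (f := fun i x => |(Hp (β i)).eval x| * (Real.exp (R * x) + Real.exp (-R * x))) fun i => ?_
      have := ((integrable_poly_exp (Hp (β i)) R).abs.add (integrable_poly_exp (Hp (β i)) (-R)).abs)
      refine this.congr (ae_of_all _ fun x => ?_)
      simp [abs_mul, mul_add]
    refine Integrable.mono' (hg.comp_fst P₀) ?_ ?_
    · exact (((HM_continuous β).comp continuous_fst).mul
        (gexM_cont.comp continuous_swap)).aestronglyMeasurable
    · have := (Measure.quasiMeasurePreserving_snd
        (μ := (Measure.pi fun _ : Fin N => gaussianReal 0 1)) (ν := P₀)).ae hae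
      filter_upwards [this] with p hp
      simp only [Function.uncurry, HM, ← Finset.prod_mul_distrib, norm_prod, norm_mul, Real.norm_eq_abs]
      refine Finset.prod_le_prod (fun i _ => by positivity) fun i _ => ?_
      refine mul_le_mul_of_nonneg_left ?_ (abs_nonneg _)
      rw [abs_of_nonneg (gex_nonneg _ _)]
      have h2 : p.2 i * p.1 i ≤ R * |p.1 i| :=
        (le_abs_self _).trans (by rw [abs_mul]; exact mul_le_mul_of_nonneg_right (hp i) (abs_nonneg _))
      have h3 : gex (p.2 i) (p.1 i) ≤ Real.exp (R * |p.1 i|) :=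
        Real.exp_le_exp.2 (by nlinarith [sq_nonneg (p.2 i)])
      refine h3.trans ?_
      rcases abs_cases (p.1 i) with ⟨h, _⟩ | ⟨h, _⟩ <;> rw [h]
      · linarith [Real.exp_pos (-R * p.1 i)]
      · rw [mul_neg, ← neg_mul]; linarith [Real.exp_pos (R * p.1 i)]

lemma moment_sum {N D : ℕ} (P₀ : Measure (Fin N → ℝ)) [IsProbabilityMeasure P₀]
    (hcompact : ∃ K : Set (Fin N → ℝ), IsCompact K ∧ P₀ Kᶜ = 0) :
    ∑ β ∈ SS N D, (∫ θ, ∏ i, θ i ^ β i ∂P₀) ^ 2 / ((∏ i, (β i).factorial : ℕ) : ℝ)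
     = ∑ d ∈ Finset.range (D + 1),
      (1 / (d.factorial : ℝ)) *
        ∫ θ, (∫ θ', (∑ i, θ i * θ' i) ^ d ∂P₀) ∂P₀ := by
  rw [sum_SS]
  refine Finset.sum_congr rfl fun d _ => ?_
  have hint : ∀ β : Fin N → ℕ, Integrable (fun θ : Fin N → ℝ => ∏ i, θ i ^ β i) P₀ := fun β =>
    integrable_of_compact P₀ hcompact (by fun_prop)
  simp_rw [Finset.sum_pow_eq_sum_piAntidiag, mul_pow, Finset.prod_mul_distrib]
  have : ∀ θ : Fin N → ℝ, ∫ θ' : Fin N → ℝ, ∑ k ∈ Finset.piAntidiag Finset.univ d,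
      (Nat.multinomial Finset.univ k : ℝ) * ((∏ i, θ i ^ k i) * ∏ i, θ' i ^ k i) ∂P₀ =
      ∑ k ∈ Finset.piAntidiag Finset.univ d,
      (Nat.multinomial Finset.univ k : ℝ) * ((∏ i, θ i ^ k i) * ∫ θ', ∏ i, θ' i ^ k i ∂P₀) := by
    intro θ
    rw [integral_finsetSum _ fun k _ => ((hint k).const_mul _).const_mul _]
    simp_rw [integral_const_mul]
  simp_rw [this]
  rw [integral_finsetSum _ fun k _ => ((hint k).mul_const _).const_mul _, Finset.mul_sum]
  refine Finset.sum_congr rfl fun k hk => ?_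
  rw [integral_const_mul, integral_mul_const]
  have hs := Nat.multinomial_spec Finset.univ k
  rw [(Finset.mem_piAntidiag.1 hk).1] at hs
  have h1 : ((∏ i, (k i).factorial : ℕ) : ℝ) ≠ 0 := by
    exact_mod_cast Finset.prod_ne_zero_iff.2 fun i _ => Nat.factorial_ne_zero _
  have h2 : (Nat.multinomial Finset.univ k : ℝ) ≠ 0 := by
    intro h
    have h' : Nat.multinomial Finset.univ k = 0 := by exact_mod_cast h
    rw [h', mul_zero] at hs
    exact Nat.factorial_ne_zero d hs.symm
  rw [← hs, Nat.cast_mul]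
  field_simp

/-- **Low-degree likelihood ratio of the real Gaussian additive model.**
Under the null `Q` (standard Gaussian on `ℝ^N`) and the planted distribution `P`
(law of `θ + Z`, `θ ∼ P₀` compactly supported, `Z ∼ Q` independent), `P ≪ Q` with
density `L(y) = E_θ[exp(⟨y,θ⟩ - ‖θ‖²/2)]`, and the orthogonal projection `L^{≤D}`
of `L` onto the subspace of `L²(Q)` spanned by polynomials of total degree `≤ D`
satisfies `‖L^{≤D}‖² = ∑_{d≤D} (1/d!) E⟨θ,θ'⟩^d`. -/
theorem stmt1 (N : ℕ) (hN : 1 ≤ N)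
    (Q : Measure (Fin N → ℝ)) [IsProbabilityMeasure Q]
    (hQ : Q = Measure.pi fun _ => gaussianReal 0 1)
    (P₀ : Measure (Fin N → ℝ)) [IsProbabilityMeasure P₀]
    (hcompact : ∃ K : Set (Fin N → ℝ), IsCompact K ∧ P₀ Kᶜ = 0)
    (P : Measure (Fin N → ℝ))
    (hP : P = (P₀.prod Q).map fun p => p.1 + p.2)
    (L : (Fin N → ℝ) → ℝ)
    (hLdef : ∀ y, L y =
      ∫ θ, Real.exp ((∑ i, y i * θ i) - (∑ i, θ i ^ 2) / 2) ∂P₀)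
    (D : ℕ)
    (V : Submodule ℝ (Lp ℝ 2 Q))
    (hV : V = Submodule.span ℝ {f : Lp ℝ 2 Q |
      ∃ p : MvPolynomial (Fin N) ℝ, p.totalDegree ≤ D ∧
        ⇑f =ᵐ[Q] fun y => MvPolynomial.eval y p})
    (Lfun LD : Lp ℝ 2 Q)
    (hLfun : ⇑Lfun =ᵐ[Q] L)
    (hmem : LD ∈ V)
    (hperp : ∀ v ∈ V, inner (𝕜 := ℝ) (Lfun - LD) v = (0 : ℝ)) :
    P ≪ Q ∧
    P = Q.withDensity (fun y => ENNReal.ofReal (L y)) ∧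
    ‖LD‖ ^ 2 = ∑ d ∈ Finset.range (D + 1),
      (1 / (d.factorial : ℝ)) *
        ∫ θ, (∫ θ', (∑ i, θ i * θ' i) ^ d ∂P₀) ∂P₀ := by
  have hL : L = fun y => ∫ θ, ∏ i, gex (θ i) (y i) ∂P₀ := by
    ext y; rw [hLdef]; simp_rw [gex_prod]
  have hdens : P = Q.withDensity (fun y => ENNReal.ofReal (L y)) := by
    rw [hP, hL]; subst hQ; exact density P₀ hcompact
  refine ⟨hdens ▸ withDensity_absolutelyContinuous _ _, hdens, ?_⟩
  rw [← moment_sum P₀ hcompact]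
  have hml : ∀ β : Fin N → ℕ, MemLp (HM β) 2 Q := fun β => hQ ▸ HM_memLp β
  set h : (Fin N → ℕ) → Lp ℝ 2 Q := fun β => (hml β).toLp (HM β) with hh
  have hc : ∀ β, ⇑(h β) =ᵐ[Q] HM β := fun β => (hml β).coeFn_toLp
  have horth : ∀ β γ, inner ℝ (h β) (h γ) = if β = γ then ((∏ i, (β i).factorial : ℕ) : ℝ) else 0 := by
    intro β γ
    rw [L2.inner_def, ← HM_orth, ← hQ]
    refine integral_congr_ae ?_
    filter_upwards [hc β, hc γ] with y h1 h2
    simp [h1, h2, mul_comm]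
  have hV1 : ∀ β ∈ SS N D, h β ∈ V := by
    intro β hβ
    rw [hV]
    refine Submodule.subset_span ⟨HMp β, (totalDegree_HMp β).trans ((mem_SS β).1 hβ), ?_⟩
    simp_rw [eval_HMp]
    exact hc β
  have hV2 : V ≤ Submodule.span ℝ (h '' (SS N D : Set (Fin N → ℕ))) := by
    rw [hV, Submodule.span_le]
    rintro f ⟨p, hp, hf⟩
    obtain ⟨a, ha⟩ := poly_expand p hp
    have : f = ∑ β ∈ SS N D, a β • h β := by
      apply Lp.ext
      have h1 : ⇑(∑ β ∈ SS N D, a β • h β) =ᵐ[Q] ∑ β ∈ SS N D, ⇑(a β • h β) := Lp.coeFn_finsetSum _ _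
      have h2 : ∀ᵐ y ∂Q, ∀ β ∈ SS N D, (a β • h β : Lp ℝ 2 Q) y = a β * HM β y := by
        rw [Finset.eventually_all]
        intro β _
        filter_upwards [Lp.coeFn_smul (a β) (h β), hc β] with y e1 e2
        rw [e1, Pi.smul_apply, e2, smul_eq_mul]
      filter_upwards [hf, h1, h2] with y e1 e2 e3
      rw [e1, e2, ha, Finset.sum_apply]
      exact Finset.sum_congr rfl fun β hβ => (e3 β hβ).symm
    rw [this]
    exact Submodule.sum_mem _ fun β hβ => Submodule.smul_mem _ _
      (Submodule.subset_span ⟨β, hβ, rfl⟩)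
  have hLh : ∀ β, inner ℝ Lfun (h β) = ∫ θ, ∏ i, θ i ^ β i ∂P₀ := by
    intro β
    rw [L2.inner_def, ← inner_L P₀ hcompact, ← hQ]
    refine integral_congr_ae ?_
    filter_upwards [hc β, hLfun] with y h1 h2
    simp [h1, h2, hL]
  have hLDh : ∀ β ∈ SS N D, inner ℝ LD (h β) = ∫ θ, ∏ i, θ i ^ β i ∂P₀ := by
    intro β hβ
    have := hperp _ (hV1 β hβ)
    rw [inner_sub_left, hLh] at this
    linarith
  obtain ⟨a, ha⟩ : ∃ a : (Fin N → ℕ) → ℝ, ∑ β ∈ SS N D, a β • h β = LD := by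
    have := hV2 hmem
    rw [Submodule.mem_span_image_finset_iff_exists_fun] at this
    obtain ⟨c, hc⟩ := this
    refine ⟨fun β => if hβ : β ∈ SS N D then c ⟨β, hβ⟩ else 0, ?_⟩
    rw [← hc, ← Finset.sum_coe_sort]
    refine Finset.sum_congr rfl fun i _ => ?_
    simp
  have hcoef : ∀ β ∈ SS N D, a β * ((∏ i, (β i).factorial : ℕ) : ℝ) = ∫ θ, ∏ i, θ i ^ β i ∂P₀ := by
    intro β hβ
    rw [← hLDh β hβ, ← ha, sum_inner]
    simp_rw [inner_smul_left, horth]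
    simp [hβ]
  rw [← real_inner_self_eq_norm_sq]
  nth_rw 2 [← ha]
  rw [inner_sum]
  refine Finset.sum_congr rfl fun β hβ => ?_
  have h1 : ((∏ i, (β i).factorial : ℕ) : ℝ) ≠ 0 := by
    exact_mod_cast Finset.prod_ne_zero_iff.2 fun i _ => Nat.factorial_ne_zero _
  rw [inner_smul_right, hLDh β hβ, ← hcoef β hβ]
  field_simp
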